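/- Let n ≥ 3 and α, β > 0. For every α/β-staircase tableau T of size n−2, the probability under ℙ_{n,α,β} of the set of tableaux S of size n such that box (n−1,1) of S contains α and S(i, j+2) = T(i,j) for every box (i,j) of T (i.e. the subtableau of S obtained by deleting the first two columns equals T) is equal to ℙ_{n−2,α,β}(T) multiplied by the probability under ℙ_{n,α,β} that box (n−1,1) contains α. In other words, conditioned on box (n−1,1) containing α, the subtableau obtained by deleting the first two columns is distributed as a random α/β-staircase tableau of size n−2 under ℙ_{n−2,α,β}. -/

import Mathlib

open scoped BigOperators

/-- A symbol in an α/β-staircase tableau: empty, α, or β. -/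
inductive StairSymb : Type
  | empty : StairSymb
  | alpha : StairSymb
  | beta  : StairSymb
  deriving DecidableEq

/-- `S` is an α/β-staircase tableau of size `n` (1-based indexing; boxes are the
pairs `(i,j)` with `1 ≤ i`, `1 ≤ j`, `i + j ≤ n + 1`; outside the boxes `S` is empty). -/
def IsStaircase (n : ℕ) (S : ℕ → ℕ → StairSymb) : Prop :=
  (∀ i j, ¬(1 ≤ i ∧ 1 ≤ j ∧ i + j ≤ n + 1) → S i j = StairSymb.empty) ∧
  (∀ i i' j, 1 ≤ i → i < i' → 1 ≤ j → i' + j ≤ n + 1 →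
    S i' j = StairSymb.alpha → S i j = StairSymb.empty) ∧
  (∀ i j j', 1 ≤ i → 1 ≤ j → j < j' → i + j' ≤ n + 1 →
    S i j' = StairSymb.beta → S i j = StairSymb.empty) ∧
  (∀ i j, 1 ≤ i → 1 ≤ j → i + j = n + 1 → S i j ≠ StairSymb.empty)

/-- The weight `wt(S) = α^{N_α(S)} β^{N_β(S)}` of a tableau. -/
noncomputable def stairWt (α β : ℝ) (S : ℕ → ℕ → StairSymb) : ℝ :=
  α ^ Set.ncard {p : ℕ × ℕ | S p.1 p.2 = StairSymb.alpha} *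
  β ^ Set.ncard {p : ℕ × ℕ | S p.1 p.2 = StairSymb.beta}

/-- The partition function `Z_n(α,β)`, the total weight of all tableaux of size `n`. -/
noncomputable def stairZ (n : ℕ) (α β : ℝ) : ℝ :=
  ∑ᶠ S ∈ {S : ℕ → ℕ → StairSymb | IsStaircase n S}, stairWt α β S

/-- The probability `ℙ_{n,α,β}(E)` of an event `E` (a set of tableaux of size `n`). -/
noncomputable def stairP (n : ℕ) (α β : ℝ) (E : (ℕ → ℕ → StairSymb) → Prop) : ℝ :=
  (∑ᶠ S ∈ {S : ℕ → ℕ → StairSymb | IsStaircase n S ∧ E S}, stairWt α β S) / stairZ n α β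

/-- The expectation `E_{n,α,β}[f]` of a real function of the random tableau. -/
noncomputable def stairE (n : ℕ) (α β : ℝ) (f : (ℕ → ℕ → StairSymb) → ℝ) : ℝ :=
  (∑ᶠ S ∈ {S : ℕ → ℕ → StairSymb | IsStaircase n S}, f S * stairWt α β S) / stairZ n α β

instance : Finite StairSymb :=
  Finite.of_surjective
    (fun k : Fin 3 => if k = 0 then StairSymb.empty else if k = 1 then .alpha else .beta) <| by
    rintro (_ | _ | _)
    exacts [⟨0, rfl⟩, ⟨1, rfl⟩, ⟨2, rfl⟩]

theorem finite_setOf_isStaircase (n : ℕ) : {S | IsStaircase n S}.Finite := by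
  refine Set.Finite.of_injOn (t := Set.univ)
    (f := fun S (i j : Fin (n + 1)) => S i j) (fun _ _ => Set.mem_univ _) ?_ Set.finite_univ
  intro S hS S' hS' h
  funext i j
  by_cases hb : 1 ≤ i ∧ 1 ≤ j ∧ i + j ≤ n + 1
  · exact congrFun (congrFun h ⟨i, by omega⟩) ⟨j, by omega⟩
  · rw [hS.1 i j hb, hS'.1 i j hb]

theorem IsStaircase.finite_setOf_eq {n : ℕ} {S : ℕ → ℕ → StairSymb} (hS : IsStaircase n S)
    {s : StairSymb} (hs : s ≠ .empty) : {p : ℕ × ℕ | S p.1 p.2 = s}.Finite := by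
  refine (Set.finite_Iic ((n + 1, n + 1) : ℕ × ℕ)).subset fun p hp => ?_
  by_contra hlt
  refine hs (hp.symm.trans (hS.1 p.1 p.2 fun hb => hlt ?_))
  exact Prod.mk_le_mk.2 ⟨by omega, by omega⟩

theorem stairWt_pos {α β : ℝ} (hα : 0 < α) (hβ : 0 < β) (S : ℕ → ℕ → StairSymb) :
    0 < stairWt α β S := by
  unfold stairWt
  positivity

theorem IsStaircase.stairZ_pos {n : ℕ} {α β : ℝ} (hα : 0 < α) (hβ : 0 < β)
    {T : ℕ → ℕ → StairSymb} (hT : IsStaircase n T) : 0 < stairZ n α β := by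
  rw [stairZ, finsum_mem_eq_finite_toFinset_sum _ (finite_setOf_isStaircase n)]
  exact Finset.sum_pos (fun S _ => stairWt_pos hα hβ S) ⟨T, by simpa using hT⟩

/-- Prepend two columns to a tableau of size `m`: the first has `α` in row `m + 1` and `β` in
row `m + 2`, the second has `α` in row `m + 1`, and all their other boxes are empty. -/
def prependAlphaCorner (m : ℕ) (T : ℕ → ℕ → StairSymb) : ℕ → ℕ → StairSymb
  | _, 0 => .empty
  | i, 1 => if i = m + 1 then .alpha else if i = m + 2 then .beta else .empty
  | i, 2 => if i = m + 1 then .alpha else .empty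
  | i, j + 3 => T i (j + 1)

theorem IsStaircase.prependAlphaCorner {m : ℕ} {T : ℕ → ℕ → StairSymb} (hT : IsStaircase m T) :
    IsStaircase (m + 2) (prependAlphaCorner m T) := by
  obtain ⟨h1, h2, h3, h4⟩ := hT
  refine ⟨?_, ?_, ?_, ?_⟩
  · rintro i (_ | _ | _ | j) h <;> simp only [_root_.prependAlphaCorner]
    · grind
    · grind
    · exact h1 _ _ (by omega)
  · rintro i i' (_ | _ | _ | j) hi hii' hj hb <;> simp only [_root_.prependAlphaCorner]
    · grind
    · grind
    · grind
    · exact h2 i i' (j + 1) hi hii' (by omega) (by omega)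
  · rintro i j (_ | _ | _ | j') hi hj hjj' hb h <;> simp only [_root_.prependAlphaCorner] at h
    · grind
    · grind
    · grind
    · rcases j with (_ | _ | _ | j) <;> simp only [_root_.prependAlphaCorner]
      · grind
      · grind
      · exact h3 i (j + 1) (j' + 1) hi (by omega) (by omega) (by omega) h
  · rintro i (_ | _ | _ | j) hi hj hb <;> simp only [_root_.prependAlphaCorner]
    · grind
    · grind
    · grind
    · exact h4 i (j + 1) hi (by omega) (by omega)

theorem IsStaircase.prependAlphaCorner_eq {m : ℕ} {S T : ℕ → ℕ → StairSymb}
    (hS : IsStaircase (m + 2) S) (hT : IsStaircase m T) (hc : S (m + 1) 1 = .alpha)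
    (h : ∀ i j : ℕ, 1 ≤ i → 1 ≤ j → i + j ≤ m + 1 → S i (j + 2) = T i j) :
    _root_.prependAlphaCorner m T = S := by
  obtain ⟨h1, h2, h3, h4⟩ := hS
  have c1 : S (m + 2) 1 = .beta := by
    have := h4 (m + 2) 1 (by omega) le_rfl rfl
    have := h2 (m + 1) (m + 2) 1 (by omega) (by omega) le_rfl (by omega)
    cases hs : S (m + 2) 1 <;> simp_all
  have c2 : S (m + 1) 2 = .alpha := by
    have := h4 (m + 1) 2 (by omega) (by omega) (by omega)
    have := h3 (m + 1) 1 2 (by omega) (by omega) (by omega) (by omega)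
    cases hs : S (m + 1) 2 <;> simp_all
  have col (i j : ℕ) (hj : 1 ≤ j) (hj2 : j ≤ 2) (hi : i < m + 1)
      (ha : S (m + 1) j = .alpha) : S i j = .empty := by
    by_cases hi0 : 1 ≤ i
    · exact h2 i (m + 1) j hi0 hi hj (by omega) ha
    · exact h1 i j (by omega)
  funext i j
  rcases j with (_ | _ | _ | j) <;> simp only [_root_.prependAlphaCorner]
  · exact (h1 _ _ (by omega)).symm
  · split_ifs with e1 e2
    · rw [e1, hc]
    · rw [e2, c1]
    · rcases lt_or_ge i (m + 1) with hi | hi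
      · exact (col i 1 (by omega) (by omega) hi hc).symm
      · exact (h1 _ _ (by omega)).symm
  · split_ifs with e1
    · rw [e1, c2]
    · rcases lt_or_ge i (m + 1) with hi | hi
      · exact (col i 2 (by omega) (by omega) hi c2).symm
      · exact (h1 _ _ (by omega)).symm
  · by_cases hb : 1 ≤ i ∧ i + (j + 1) ≤ m + 1
    · exact (h i (j + 1) hb.1 (by omega) hb.2).symm
    · rw [h1 _ _ (by omega), hT.1 _ _ (by omega)]

/-- The subtableau obtained by deleting the first two columns. -/
def dropTwoColumns (S : ℕ → ℕ → StairSymb) (i j : ℕ) : StairSymb :=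
  if j = 0 then .empty else S i (j + 2)

theorem IsStaircase.dropTwoColumns {m : ℕ} {S : ℕ → ℕ → StairSymb}
    (hS : IsStaircase (m + 2) S) : IsStaircase m (dropTwoColumns S) := by
  obtain ⟨h1, h2, h3, h4⟩ := hS
  refine ⟨fun i j h => ?_, fun i i' j hi hii' hj hb => ?_, fun i j j' hi hj hjj' hb => ?_,
    fun i j hi hj hb => ?_⟩ <;> simp only [_root_.dropTwoColumns]
  · split_ifs with hj
    · rfl
    · exact h1 _ _ (by omega)
  · simpa only [show j ≠ 0 by omega, if_false] using
      h2 i i' (j + 2) hi hii' (by omega) (by omega)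
  · simpa only [show j ≠ 0 by omega, show j' ≠ 0 by omega, if_false] using
      h3 i (j + 2) (j' + 2) hi (by omega) (by omega) (by omega)
  · simpa only [show j ≠ 0 by omega, if_false] using h4 i (j + 2) hi (by omega) (by omega)

theorem prependAlphaCorner_injOn (m : ℕ) :
    Set.InjOn (prependAlphaCorner m) {T | IsStaircase m T} := by
  intro T hT T' hT' h
  funext i j
  rcases j with _ | j
  · rw [hT.1 _ _ (by omega), hT'.1 _ _ (by omega)]
  · exact congrFun (congrFun h i) (j + 3)

theorem prependAlphaCorner_corner (m : ℕ) (T : ℕ → ℕ → StairSymb) :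
    prependAlphaCorner m T (m + 1) 1 = .alpha := by
  simp [prependAlphaCorner]

theorem setOf_isStaircase_alpha_corner (m : ℕ) :
    {S | IsStaircase (m + 2) S ∧ S (m + 1) 1 = .alpha} =
      prependAlphaCorner m '' {T | IsStaircase m T} := by
  ext S
  constructor
  · rintro ⟨hS, hc⟩
    refine ⟨dropTwoColumns S, hS.dropTwoColumns,
      hS.prependAlphaCorner_eq hS.dropTwoColumns hc fun i j _ hj _ => ?_⟩
    rw [dropTwoColumns, if_neg (by omega)]
  · rintro ⟨T, hT, rfl⟩
    exact ⟨hT.prependAlphaCorner, prependAlphaCorner_corner m T⟩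

theorem IsStaircase.stairWt_prependAlphaCorner {m : ℕ} {T : ℕ → ℕ → StairSymb}
    (hT : IsStaircase m T) (α β : ℝ) :
    stairWt α β (_root_.prependAlphaCorner m T) = α ^ 2 * β * stairWt α β T := by
  let f : ℕ × ℕ → ℕ × ℕ := fun p => (p.1, p.2 + 2)
  have hf : f.Injective := by
    rintro ⟨a, b⟩ ⟨c, d⟩ h
    simpa [f] using h
  have h0 (i : ℕ) : T i 0 = .empty := hT.1 _ _ (by omega)
  have ha : {p : ℕ × ℕ | _root_.prependAlphaCorner m T p.1 p.2 = .alpha} =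
      insert (m + 1, 1) (insert (m + 1, 2) (f '' {p | T p.1 p.2 = .alpha})) := by
    ext ⟨i, _ | _ | _ | j⟩ <;> simp [_root_.prependAlphaCorner, f, h0]
    · grind
  have hb : {p : ℕ × ℕ | _root_.prependAlphaCorner m T p.1 p.2 = .beta} =
      insert (m + 2, 1) (f '' {p | T p.1 p.2 = .beta}) := by
    ext ⟨i, _ | _ | _ | j⟩ <;> simp [_root_.prependAlphaCorner, f, h0]
    · grind
    · grind
  have fa := (hT.finite_setOf_eq (s := .alpha) (by simp)).image f
  have fb := (hT.finite_setOf_eq (s := .beta) (by simp)).image f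
  rw [stairWt, ha, hb,
    Set.ncard_insert_of_notMem (by simp [f]) (fa.insert _),
    Set.ncard_insert_of_notMem (by simp [f, h0]) fa,
    Set.ncard_insert_of_notMem (by simp [f]) fb,
    Set.ncard_image_of_injective _ hf, Set.ncard_image_of_injective _ hf, stairWt]
  ring

/-- Conditioned on box `(n−1,1)` containing α, the subtableau obtained by deleting the
first two columns is distributed as a random tableau of size `n−2`. -/
theorem subtableau_given_alpha_corner (n : ℕ) (hn : 3 ≤ n) (α β : ℝ) (hα : 0 < α) (hβ : 0 < β)
    (T : ℕ → ℕ → StairSymb) (hT : IsStaircase (n - 2) T) :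
    stairP n α β (fun S => S (n - 1) 1 = StairSymb.alpha ∧
        ∀ i j : ℕ, 1 ≤ i → 1 ≤ j → i + j ≤ n - 1 → S i (j + 2) = T i j)
      = stairP (n - 2) α β (fun S => S = T) *
        stairP n α β (fun S => S (n - 1) 1 = StairSymb.alpha) := by
  obtain ⟨m, rfl⟩ : ∃ m, n = m + 2 := ⟨n - 2, by omega⟩
  simp only [show m + 2 - 2 = m by omega, show m + 2 - 1 = m + 1 by omega] at hT ⊢
  have hZ := (hT.stairZ_pos hα hβ).ne'
  have hE : {S | IsStaircase (m + 2) S ∧ S (m + 1) 1 = StairSymb.alpha ∧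
      ∀ i j : ℕ, 1 ≤ i → 1 ≤ j → i + j ≤ m + 1 → S i (j + 2) = T i j} =
      {prependAlphaCorner m T} := by
    ext S
    constructor
    · rintro ⟨hS, hc, h⟩
      exact (hS.prependAlphaCorner_eq hT hc h).symm
    · rintro rfl
      refine ⟨hT.prependAlphaCorner, prependAlphaCorner_corner m T, fun i j _ hj _ => ?_⟩
      obtain ⟨k, rfl⟩ := Nat.exists_eq_add_of_le' hj
      rfl
  have hTs : {S | IsStaircase m S ∧ S = T} = {T} := by
    ext S
    exact ⟨fun h => h.2, fun h => ⟨h ▸ hT, h⟩⟩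
  have hA : ∑ᶠ S ∈ {S | IsStaircase (m + 2) S ∧ S (m + 1) 1 = StairSymb.alpha}, stairWt α β S =
      α ^ 2 * β * stairZ m α β := by
    rw [setOf_isStaircase_alpha_corner, finsum_mem_image (prependAlphaCorner_injOn m), stairZ,
      mul_finsum_mem]
    exact finsum_mem_congr rfl fun S hS => IsStaircase.stairWt_prependAlphaCorner hS α β
  rw [stairP, stairP, stairP, hE, hTs, hA, finsum_mem_singleton, finsum_mem_singleton,
    hT.stairWt_prependAlphaCorner]
  field_simp
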